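/- arXiv:2407.09368 — 2 statements merged into one kernel-verified Lean document; each statement's English description precedes it below -/
import Mathlib

section
/- Let (S_i)_{i∈I} be a finite indexed family of finite sets in which every set satisfies |S_i| ≤ d, where d ≥ 2 is an integer, and let ε̂ ∈ (0,1) be such that β = 1/H_{⌈d(d−1)/ε̂⌉} − ε̂ > 0. Then there exists J ⊆ I such that |Ũ(J)| ≥ (β/(1+β)) · |ψ(I)|. -/
open Finset

/-- The cover of the subfamily indexed by `J`: ψ(J) = ⋃_{i ∈ J} S i. -/
def cov {α ι : Type*} [DecidableEq α] (S : ι → Finset α) (J : Finset ι) : Finset α :=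
  J.biUnion S

/-- The unique cover of the subfamily indexed by `J`:
Ũ(J) = {x : x ∈ S i for exactly one i ∈ J}. -/
def uniqCov {α ι : Type*} [DecidableEq α] [DecidableEq ι] (S : ι → Finset α) (J : Finset ι) :
    Finset α :=
  (J.biUnion S).filter fun x => (J.filter fun i => x ∈ S i).card = 1

/-- The non-unique cover of the subfamily indexed by `J`:
ψ_{≥2}(J) = {x : x ∈ S i for at least two i ∈ J}. -/
def nonUniqCov {α ι : Type*} [DecidableEq α] [DecidableEq ι] (S : ι → Finset α) (J : Finset ι) :
    Finset α :=
  (J.biUnion S).filter fun x => 2 ≤ (J.filter fun i => x ∈ S i).card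


lemma aux_riemann (k M : ℕ) :
    (M : ℝ) ^ (k + 1) ≤ (k + 1) * ∑ i ∈ range M, (i : ℝ) ^ k + (k + 1) * (M : ℝ) ^ k := by
  have h : ∀ M : ℕ, (M : ℝ) ^ (k + 1) ≤ (k + 1) * ∑ i ∈ range M, ((i : ℝ) + 1) ^ k := by
    intro M
    induction M with
    | zero => simp
    | succ n ih =>
      rw [sum_range_succ, mul_add]
      have h1 : ((n : ℝ) + 1) ^ (k + 1) - (n : ℝ) ^ (k + 1) ≤ (k + 1) * ((n : ℝ) + 1) ^ k := by
        have hn : (0 : ℝ) ≤ n := Nat.cast_nonneg n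
        rw [← (Commute.all ((n : ℝ) + 1) n).mul_geom_sum₂ (k + 1)]
        have : ∀ i ∈ range (k + 1), ((n : ℝ) + 1) ^ i * (n : ℝ) ^ (k + 1 - 1 - i)
            ≤ ((n : ℝ) + 1) ^ k := by
          intro i hi
          have hi' : i ≤ k := by simpa [Nat.lt_succ_iff] using hi
          calc ((n : ℝ) + 1) ^ i * (n : ℝ) ^ (k + 1 - 1 - i)
              ≤ ((n : ℝ) + 1) ^ i * ((n : ℝ) + 1) ^ (k + 1 - 1 - i) := by
                gcongr; linarith
            _ = ((n : ℝ) + 1) ^ k := by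
                rw [← pow_add]; congr 1; omega
        have h2 := sum_le_sum this
        simp only [sum_const, card_range, nsmul_eq_mul] at h2
        push_cast at h2
        simp only [Nat.add_sub_cancel, add_sub_cancel_left, one_mul] at h2 ⊢
        exact h2
      push_cast
      linarith
  have h2 : ∑ i ∈ range M, ((i : ℝ) + 1) ^ k ≤ ∑ i ∈ range M, (i : ℝ) ^ k + (M : ℝ) ^ k := by
    rw [← sum_range_succ (fun i : ℕ => (i : ℝ) ^ k), sum_range_succ']
    push_cast
    have : (0 : ℝ) ≤ (0 : ℝ) ^ k := by positivity
    linarith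
  have h3 := h M
  have h4 : ((k : ℝ) + 1) * ∑ i ∈ range M, ((i : ℝ) + 1) ^ k
      ≤ (k + 1) * (∑ i ∈ range M, (i : ℝ) ^ k + (M : ℝ) ^ k) := by
    gcongr
  linarith

/-- weighted count over p = (j+1)/M with weight 1/(j+1) -/
lemma aux_weight (k M : ℕ) (hM : 0 < M) :
    1 - ((k : ℝ) + 1) / M ≤ ∑ j ∈ range M, (1 / ((j : ℝ) + 1)) *
      ((k + 1) * (((j : ℝ) + 1) / M) * (1 - ((j : ℝ) + 1) / M) ^ k) := by
  have hM' : (0 : ℝ) < M := by exact_mod_cast hM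
  have e : ∑ j ∈ range M, (1 / ((j : ℝ) + 1)) *
      ((k + 1) * (((j : ℝ) + 1) / M) * (1 - ((j : ℝ) + 1) / M) ^ k)
      = (k + 1) * (∑ i ∈ range M, (i : ℝ) ^ k) / M ^ (k + 1) := by
    rw [← sum_range_reflect (fun i : ℕ => (i : ℝ) ^ k), mul_sum, sum_div]
    refine sum_congr rfl fun j hj => ?_
    have hj' : j + 1 ≤ M := by simpa using hj
    have : ((M - 1 - j : ℕ) : ℝ) = M - (j + 1) := by
      rw [Nat.sub_sub, add_comm 1 j, Nat.cast_sub hj']; push_cast; ring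
    rw [this]
    have : (1 - ((j : ℝ) + 1) / M) = (M - (j + 1)) / M := by field_simp
    rw [this, div_pow]
    have : (j : ℝ) + 1 ≠ 0 := by positivity
    field_simp
    ring
  rw [e, le_div_iff₀ (by positivity)]
  have := aux_riemann k M
  have h2 : (1 - ((k : ℝ) + 1) / M) * (M : ℝ) ^ (k + 1) = M ^ (k + 1) - (k + 1) * M ^ k := by
    field_simp
    ring
  linarith

lemma aux_prob {ι : Type*} [DecidableEq ι] (J D : Finset ι) (hD : D ⊆ J) (p : ℝ) :
    ∑ A ∈ J.powerset, p ^ A.card * (1 - p) ^ (J.card - A.card) *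
      (if (A ∩ D).card = 1 then (1 : ℝ) else 0) = D.card * p * (1 - p) ^ (D.card - 1) := by
  have h1 : ∀ i ∈ D, ∑ A ∈ J.powerset, p ^ A.card * (1 - p) ^ (J.card - A.card) *
      (if A ∩ D = {i} then (1 : ℝ) else 0) = p * (1 - p) ^ (D.card - 1) := by
    intro i hi
    have key := prod_add (fun l => if l ∈ D ∧ l ≠ i then 0 else p)
      (fun l => if l = i then 0 else 1 - p) J
    have hR : ∏ l ∈ J, ((if l ∈ D ∧ l ≠ i then 0 else p) + (if l = i then 0 else 1 - p))
        = p * (1 - p) ^ (D.card - 1) := by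
      rw [← prod_sdiff hD, ← mul_prod_erase D _ hi]
      rw [prod_eq_one, prod_congr rfl (g := fun _ => 1 - p)]
      · simp [card_erase_of_mem hi]
      · intro l hl
        simp at hl
        simp [hl]
      · intro l hl
        simp at hl
        have : l ≠ i := by rintro rfl; exact hl.2 hi
        simp [hl, this]
    rw [hR] at key
    rw [key]
    refine sum_congr rfl fun A hA => ?_
    rw [mem_powerset] at hA
    split_ifs with h
    · have hiA : i ∈ A ∧ i ∈ D := by rw [← mem_inter, h]; simp
      rw [prod_congr rfl (g := fun _ => p), prod_congr (s₁ := J \ A) rfl (g := fun _ => 1 - p)]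
      · simp [card_sdiff_of_subset hA]
      · intro l hl
        simp at hl
        have : l ≠ i := by rintro rfl; exact hl.2 hiA.1
        simp [this]
      · intro l hl
        rw [if_neg]
        rintro ⟨h3, h4⟩
        have : l ∈ A ∩ D := by simp [hl, h3]
        rw [h] at this
        simp at this
        exact h4 this
    · rw [mul_zero]
      symm
      by_cases hiA : i ∈ A
      · have : ∃ l ∈ A ∩ D, l ≠ i := by
          by_contra hc
          push Not at hc
          exact h (eq_singleton_iff_unique_mem.2 ⟨by simp [hiA, hi], hc⟩)
        obtain ⟨l, hl, hli⟩ := this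
        rw [mem_inter] at hl
        rw [prod_eq_zero hl.1 (by simp [hl.2, hli]), zero_mul]
      · rw [mul_comm, prod_eq_zero (i := i) (by simp [hiA, hD hi]) (by simp), zero_mul]
  have h2 : ∀ A : Finset ι, (if (A ∩ D).card = 1 then (1 : ℝ) else 0)
      = ∑ i ∈ D, if A ∩ D = {i} then (1 : ℝ) else 0 := by
    intro A
    split_ifs with h
    · obtain ⟨i, hi⟩ := card_eq_one.1 h
      have : i ∈ D := by
        have : i ∈ A ∩ D := by rw [hi]; simp
        exact (mem_inter.1 this).2
      simp [hi, this]
    · symm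
      apply sum_eq_zero
      intro i _
      rw [if_neg]
      intro h'
      exact h (by rw [h']; simp)
  simp_rw [h2, mul_sum]
  rw [sum_comm, sum_congr rfl h1]
  simp [mul_assoc]

lemma aux_main {α ι : Type*} [DecidableEq α] [DecidableEq ι]
    (J : Finset ι) (S : ι → Finset α) (M : ℕ) (hM : 0 < M) (B : ℝ)
    (hB : ∀ A ⊆ J, ((uniqCov S A).card : ℝ) ≤ B) :
    ((cov S J).card : ℝ) - (∑ i ∈ J, ((S i).card : ℝ)) / M ≤
      ((harmonic M : ℚ) : ℝ) * B := by
  have hM' : (0 : ℝ) < M := by exact_mod_cast hM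
  let D : α → Finset ι := fun x => J.filter fun i => x ∈ S i
  have hu : ∀ A ∈ J.powerset, ((uniqCov S A).card : ℝ)
      = ∑ x ∈ cov S J, if (A ∩ D x).card = 1 then (1 : ℝ) else 0 := by
    intro A hA
    rw [mem_powerset] at hA
    rw [sum_boole]
    congr 2
    ext x
    have e : A ∩ D x = A.filter fun i => x ∈ S i := by
      ext i; simp only [D, mem_inter, mem_filter]
      constructor
      · tauto
      · rintro ⟨h1, h2⟩; exact ⟨h1, hA h1, h2⟩
    rw [mem_filter, e, uniqCov, mem_filter]
    constructor
    · rintro ⟨h1, h2⟩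
      exact ⟨biUnion_subset_biUnion_of_subset_left S hA h1, h2⟩
    · rintro ⟨h1, h2⟩
      refine ⟨?_, h2⟩
      obtain ⟨i, hi⟩ := card_eq_one.1 h2
      have : i ∈ A.filter fun i => x ∈ S i := by rw [hi]; simp
      rw [mem_filter] at this
      exact mem_biUnion.2 ⟨i, this⟩
  have hexp : ∀ p : ℝ, 0 ≤ p → p ≤ 1 →
      ∑ x ∈ cov S J, ((D x).card : ℝ) * p * (1 - p) ^ ((D x).card - 1) ≤ B := by
    intro p hp0 hp1
    have hq : 0 ≤ 1 - p := by linarith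
    have h1 : ∑ x ∈ cov S J, ((D x).card : ℝ) * p * (1 - p) ^ ((D x).card - 1)
        = ∑ A ∈ J.powerset, p ^ A.card * (1 - p) ^ (J.card - A.card) *
            ((uniqCov S A).card : ℝ) := by
      rw [sum_congr rfl fun x _ => (aux_prob J (D x) (filter_subset _ _) p).symm, sum_comm]
      refine sum_congr rfl fun A hA => ?_
      rw [hu A hA, mul_sum]
    rw [h1]
    calc _ ≤ ∑ A ∈ J.powerset, p ^ A.card * (1 - p) ^ (J.card - A.card) * B := by
          refine sum_le_sum fun A hA => ?_
          exact mul_le_mul_of_nonneg_left (hB A (mem_powerset.1 hA)) (by positivity)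
      _ = B := by
          rw [← sum_mul, sum_pow_mul_eq_add_pow]; simp
  have hdeg : ∑ x ∈ cov S J, ((D x).card : ℝ) = ∑ i ∈ J, ((S i).card : ℝ) := by
    have := sum_card_bipartiteAbove_eq_sum_card_bipartiteBelow (s := cov S J) (t := J)
      (fun x i => x ∈ S i)
    have e : ∀ i ∈ J, (bipartiteBelow (fun x i => x ∈ S i) (cov S J) i).card = (S i).card := by
      intro i hi
      congr 1
      ext x
      simp only [bipartiteBelow, mem_filter, cov, mem_biUnion]
      exact ⟨fun h => h.2, fun h => ⟨⟨i, hi, h⟩, h⟩⟩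
    rw [sum_congr rfl e] at this
    exact_mod_cast this
  have hx : ∀ x ∈ cov S J, 1 - ((D x).card : ℝ) / M ≤ ∑ j ∈ range M, (1 / ((j : ℝ) + 1)) *
      (((D x).card : ℝ) * (((j : ℝ) + 1) / M) * (1 - ((j : ℝ) + 1) / M) ^ ((D x).card - 1)) := by
    intro x hx
    obtain ⟨i, hi, hxi⟩ := mem_biUnion.1 hx
    have : 0 < (D x).card := card_pos.2 ⟨i, by simp [D, hi, hxi]⟩
    obtain ⟨k, hk⟩ := Nat.exists_eq_succ_of_ne_zero this.ne'
    have := aux_weight k M hM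
    rw [hk]
    simpa using this
  calc ((cov S J).card : ℝ) - (∑ i ∈ J, ((S i).card : ℝ)) / M
      = ∑ x ∈ cov S J, (1 - ((D x).card : ℝ) / M) := by
        rw [sum_sub_distrib, ← sum_div, hdeg]; simp
    _ ≤ _ := sum_le_sum hx
    _ = ∑ j ∈ range M, (1 / ((j : ℝ) + 1)) * ∑ x ∈ cov S J, (((D x).card : ℝ) *
          (((j : ℝ) + 1) / M) * (1 - ((j : ℝ) + 1) / M) ^ ((D x).card - 1)) := by
        rw [sum_comm]; simp_rw [mul_sum]
    _ ≤ ∑ j ∈ range M, (1 / ((j : ℝ) + 1)) * B := by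
        refine sum_le_sum fun j hj => ?_
        refine mul_le_mul_of_nonneg_left (hexp _ (by positivity) ?_) (by positivity)
        rw [div_le_one hM']
        have : j + 1 ≤ M := by simpa using hj
        exact_mod_cast this
    _ = _ := by
        rw [← sum_mul, harmonic]; push_cast; simp

lemma aux_cover {α ι : Type*} [DecidableEq α] [DecidableEq ι]
    (I : Finset ι) (S : ι → Finset α) :
    ∃ J ⊆ I, cov S J = cov S I ∧ J.card ≤ (cov S I).card := by
  have h : ∀ x : cov S I, ∃ i ∈ I, (x : α) ∈ S i := fun x => mem_biUnion.1 x.2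
  choose f hf hfS using h
  refine ⟨(univ : Finset (cov S I)).image f, ?_, ?_, ?_⟩
  · intro i hi
    obtain ⟨x, _, rfl⟩ := mem_image.1 hi
    exact hf x
  · apply subset_antisymm
    · refine biUnion_subset_biUnion_of_subset_left S ?_
      intro i hi
      obtain ⟨x, _, rfl⟩ := mem_image.1 hi
      exact hf x
    · intro x hx
      exact mem_biUnion.2 ⟨f ⟨x, hx⟩, mem_image_of_mem _ (mem_univ _), hfS ⟨x, hx⟩⟩
  · exact card_image_le.trans (by simp)

/-- If every set of the family has size at most d (d ≥ 2), ε̂ ∈ (0,1), and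
β = 1/H_{⌈d(d−1)/ε̂⌉} − ε̂ > 0, then some subfamily J ⊆ I has |Ũ(J)| ≥ (β/(1+β)) · |ψ(I)|. -/
theorem stmt_5 {α ι : Type*} [DecidableEq α] [DecidableEq ι]
    (I : Finset ι) (S : ι → Finset α) (d : ℕ) (hd : 2 ≤ d)
    (hsize : ∀ i ∈ I, (S i).card ≤ d)
    (εhat : ℝ) (hεhat : εhat ∈ Set.Ioo (0 : ℝ) 1)
    (β : ℝ) (hβdef : β = 1 / ((harmonic ⌈(d : ℝ) * ((d : ℝ) - 1) / εhat⌉₊ : ℚ) : ℝ) - εhat)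
    (hβ : 0 < β) :
    ∃ J ⊆ I, ((uniqCov S J).card : ℝ) ≥ (β / (1 + β)) * ((cov S I).card : ℝ) := by
  obtain ⟨hε0, hε1⟩ := hεhat
  obtain ⟨J, hJI, hcov, hcard⟩ := aux_cover I S
  set M := ⌈(d : ℝ) * ((d : ℝ) - 1) / εhat⌉₊ with hMdef
  have hd' : (2 : ℝ) ≤ d := by exact_mod_cast hd
  have hMge : (d : ℝ) * ((d : ℝ) - 1) / εhat ≤ M := Nat.le_ceil _
  have hpos : 0 < (d : ℝ) * ((d : ℝ) - 1) / εhat := by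
    apply div_pos _ hε0; nlinarith
  have hM0' : (0 : ℝ) < M := lt_of_lt_of_le hpos hMge
  have hM0 : 0 < M := by exact_mod_cast hM0'
  have hdM : (d : ℝ) / M ≤ εhat := by
    rw [div_le_iff₀ hM0']
    rw [div_le_iff₀ hε0] at hMge
    nlinarith
  have hH : (1 : ℝ) ≤ ((harmonic M : ℚ) : ℝ) := by
    have : (1 : ℚ) ≤ harmonic M := by
      rw [harmonic]
      have := single_le_sum (f := fun i : ℕ => ((↑(i + 1) : ℚ))⁻¹) (s := range M)
        (fun i _ => by positivity) (mem_range.2 hM0)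
      simpa using this
    exact_mod_cast this
  obtain ⟨A, hA, hmax⟩ := exists_max_image J.powerset (fun A => (uniqCov S A).card)
    ⟨∅, empty_mem_powerset J⟩
  rw [mem_powerset] at hA
  refine ⟨A, hA.trans hJI, ?_⟩
  have hmain := aux_main J S M hM0 ((uniqCov S A).card : ℝ)
    (fun A' hA' => by exact_mod_cast hmax A' (mem_powerset.2 hA'))
  rw [hcov] at hmain
  set H := ((harmonic M : ℚ) : ℝ)
  set n := ((cov S I).card : ℝ)
  set u := ((uniqCov S A).card : ℝ)
  have hn : 0 ≤ n := Nat.cast_nonneg _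
  have hsum : ∑ i ∈ J, ((S i).card : ℝ) ≤ n * d := by
    calc ∑ i ∈ J, ((S i).card : ℝ) ≤ ∑ i ∈ J, (d : ℝ) :=
          sum_le_sum fun i hi => by exact_mod_cast hsize i (hJI hi)
      _ = J.card * d := by simp
      _ ≤ n * d := by
          apply mul_le_mul_of_nonneg_right _ (by linarith)
          exact Nat.cast_le.2 hcard
  have h1 : (∑ i ∈ J, ((S i).card : ℝ)) / M ≤ n * εhat := by
    calc _ ≤ n * d / M := by gcongr
      _ = n * (d / M) := by ring
      _ ≤ n * εhat := by gcongr
  have h2 : n * (1 - εhat) ≤ H * u := by linarith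
  have hH0 : 0 < H := by linarith
  have h3 : β * n ≤ u := by
    have : H * (β * n) ≤ H * u := by
      have e : H * (β * n) = n * (1 - H * εhat) := by
        rw [hβdef]; field_simp
      rw [e]
      refine le_trans ?_ h2
      apply mul_le_mul_of_nonneg_left _ hn
      nlinarith
    exact le_of_mul_le_mul_left this hH0
  have h4 : β / (1 + β) ≤ β := div_le_self hβ.le (by linarith)
  exact le_trans (mul_le_mul_of_nonneg_right h4 hn) h3
end

section
/- Let (S_i)_{i∈I} be a finite indexed family of finite sets, let G_1, …, G_g be pairwise disjoint subsets of I, and define the group family (T_j)_{j∈{1,…,g}} by T_j = ψ(G_j) = ⋃_{i∈G_j} S_i. For any K ⊆ {1,…,g}, letting B = ⋃_{j∈K} G_j ⊆ I, the unique cover of B with respect to the family (S_i) equals the unique cover of K with respect to the group family (T_j) minus ⋃_{j∈K} ψ_{≥2}(G_j); that is, Ũ_{(S_i)}(B) = Ũ_{(T_j)}(K) \ ⋃_{j∈K} ψ_{≥2}(G_j). -/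
open Finset

theorem mem_uniqCov_aux {α ι : Type*} [DecidableEq α] [DecidableEq ι] (S : ι → Finset α)
    (J : Finset ι) (x : α) :
    x ∈ uniqCov S J ↔ ∃ i ∈ J, x ∈ S i ∧ ∀ k ∈ J, x ∈ S k → k = i := by
  unfold uniqCov
  rw [Finset.mem_filter, Finset.mem_biUnion, Finset.card_eq_one]
  constructor
  · rintro ⟨-, i, hi⟩
    have h : ∀ k, (k ∈ J ∧ x ∈ S k) ↔ k = i := fun k => by
      rw [← Finset.mem_filter (p := fun i => x ∈ S i), hi, Finset.mem_singleton]
    exact ⟨i, ((h i).2 rfl).1, ((h i).2 rfl).2, fun k hk hx => (h k).1 ⟨hk, hx⟩⟩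
  · rintro ⟨i, hi, hx, h⟩
    refine ⟨⟨i, hi, hx⟩, i, ?_⟩
    ext k
    rw [Finset.mem_filter, Finset.mem_singleton]
    exact ⟨fun hk => h k hk.1 hk.2, fun hk => hk ▸ ⟨hi, hx⟩⟩

theorem mem_nonUniqCov_aux {α ι : Type*} [DecidableEq α] [DecidableEq ι] (S : ι → Finset α)
    (J : Finset ι) (x : α) :
    x ∈ nonUniqCov S J ↔ ∃ a ∈ J, ∃ b ∈ J, x ∈ S a ∧ x ∈ S b ∧ a ≠ b := by
  unfold nonUniqCov
  rw [Finset.mem_filter, Finset.mem_biUnion, ← Nat.lt_iff_add_one_le, Finset.one_lt_card]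
  simp only [Finset.mem_filter]
  constructor
  · rintro ⟨-, a, ha, b, hb, h⟩
    exact ⟨a, ha.1, b, hb.1, ha.2, hb.2, h⟩
  · rintro ⟨a, ha, b, hb, hxa, hxb, h⟩
    exact ⟨⟨a, ha, hxa⟩, a, ⟨ha, hxa⟩, b, ⟨hb, hxb⟩, h⟩

/-- For pairwise disjoint groups G_1, …, G_g ⊆ I with group covers
T_j = ψ(G_j), any K ⊆ {1,…,g} with B = ⋃_{j∈K} G_j satisfies
Ũ_{(S_i)}(B) = Ũ_{(T_j)}(K) \ ⋃_{j∈K} ψ_{≥2}(G_j). -/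
theorem stmt_12 {α ι : Type*} [DecidableEq α] [DecidableEq ι]
    (I : Finset ι) (S : ι → Finset α) (g : ℕ) (G : Fin g → Finset ι)
    (hGsub : ∀ j, G j ⊆ I)
    (hGdisj : ∀ j j' : Fin g, j ≠ j' → Disjoint (G j) (G j'))
    (K : Finset (Fin g)) :
    uniqCov S (K.biUnion G) =
      uniqCov (fun j => cov S (G j)) K \ K.biUnion (fun j => nonUniqCov S (G j)) := by
  ext x
  simp only [Finset.mem_sdiff, mem_uniqCov_aux, Finset.mem_biUnion, mem_nonUniqCov_aux, cov]
  constructor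
  · rintro ⟨i, ⟨j, hj, hij⟩, hx, h⟩
    refine ⟨⟨j, hj, ⟨i, hij, hx⟩, ?_⟩, ?_⟩
    · rintro k hk ⟨i', hi', hx'⟩
      have e := h i' ⟨k, hk, hi'⟩ hx'
      subst e
      by_contra hne
      exact Finset.disjoint_left.1 (hGdisj k j hne) hi' hij
    · rintro ⟨k, hk, a, ha, b, hb, hxa, hxb, hne⟩
      exact hne ((h a ⟨k, hk, ha⟩ hxa).trans (h b ⟨k, hk, hb⟩ hxb).symm)
  · rintro ⟨⟨j, hj, ⟨i, hi, hx⟩, h⟩, hn⟩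
    refine ⟨i, ⟨j, hj, hi⟩, hx, ?_⟩
    rintro k ⟨j', hj', hk⟩ hxk
    have e := h j' hj' ⟨k, hk, hxk⟩
    subst e
    by_contra hne
    exact hn ⟨j', hj', k, hk, i, hi, hxk, hx, hne⟩
end
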